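/- arXiv:1601.02484 — 9 statements merged into one kernel-verified Lean document; each statement's English description precedes it below -/
import Mathlib

section
/- Let μ be a monad satisfying the monad laws, and let mget : A → B and mput : A → B → μ A be functions such that for all a : A and b : B, (mput a b >>= fun a' => pure (a', mget a')) = (mput a b >>= fun a' => pure (a', b)). Then for every type γ, every continuation k : A → B → μ γ, and all a : A, b : B, we have (mput a b >>= fun a' => k a' (mget a')) = (mput a b >>= fun a' => k a' b). (In other words, the law (MPutGet) follows from its special case with k a b = pure (a, b).) -/
universe u v

/-- the general (MPutGet) law follows from its special case with
`k a b = pure (a, b)`. -/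
theorem mputget_of_special_case
    {μ : Type u → Type v} [Monad μ] [LawfulMonad μ] {A B : Type u}
    (mget : A → B) (mput : A → B → μ A)
    (h : ∀ (a : A) (b : B),
      (mput a b >>= fun a' => pure (a', mget a')) =
      (mput a b >>= fun a' => pure (a', b)))
    (γ : Type u) (k : A → B → μ γ) (a : A) (b : B) :
    (mput a b >>= fun a' => k a' (mget a')) =
    (mput a b >>= fun a' => k a' b) := by
  have h2 := congrArg (fun m => m >>= fun p : A × B => k p.1 p.2) (h a b)
  simp only [bind_assoc, pure_bind] at h2
  exact h2
end

section
/- If l1 is a well-behaved μ-lens from A to B and l2 is a well-behaved μ-lens from B to C, where μ is a monad satisfying the monad laws, then the composition l1 ; l2 is a well-behaved μ-lens from A to C, i.e. it satisfies (MGetPut), (MPutGet), and (MCreateGet). -/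
universe u v

structure MLens (μ : Type u → Type v) (A B : Type u) where
  mget : A → B
  mput : A → B → μ A
  mcreate : B → μ A

/-- A monadic lens is well-behaved if it satisfies (MGetPut), (MPutGet) and (MCreateGet). -/
def MLens.WellBehaved {μ : Type u → Type v} [Monad μ] {A B : Type u}
    (l : MLens μ A B) : Prop :=
  (∀ a, l.mput a (l.mget a) = pure a) ∧
  (∀ (γ : Type u) (k : A → B → μ γ) (a : A) (b : B),
    (l.mput a b >>= fun a' => k a' (l.mget a')) =
    (l.mput a b >>= fun a' => k a' b)) ∧
  (∀ (γ : Type u) (k : A → B → μ γ) (b : B),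
    (l.mcreate b >>= fun a => k a (l.mget a)) =
    (l.mcreate b >>= fun a => k a b))

/-- Composition of monadic lenses. -/
def MLens.comp {μ : Type u → Type v} [Monad μ] {A B C : Type u}
    (l1 : MLens μ A B) (l2 : MLens μ B C) : MLens μ A C where
  mget a := l2.mget (l1.mget a)
  mput a c := l2.mput (l1.mget a) c >>= fun b => l1.mput a b
  mcreate c := l2.mcreate c >>= fun b => l1.mcreate b

/-- composition of well-behaved monadic lenses is well-behaved. -/
theorem mlens_comp_wellBehaved {μ : Type u → Type v} [Monad μ] [LawfulMonad μ]
    {A B C : Type u} (l1 : MLens μ A B) (l2 : MLens μ B C)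
    (h1 : l1.WellBehaved) (h2 : l2.WellBehaved) :
    (l1.comp l2).WellBehaved := by
  obtain ⟨gp1, pg1, cg1⟩ := h1
  obtain ⟨gp2, pg2, cg2⟩ := h2
  refine ⟨?_, ?_, ?_⟩
  · intro a
    simp only [MLens.comp, gp2, pure_bind, gp1]
  · intro γ k a c
    simp only [MLens.comp, bind_assoc]
    have e : ∀ b, (l1.mput a b >>= fun a' => k a' (l2.mget (l1.mget a'))) =
        (l1.mput a b >>= fun a' => k a' (l2.mget b)) :=
      fun b => pg1 γ (fun a' b' => k a' (l2.mget b')) a b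
    simp only [e]
    exact pg2 γ (fun b c' => l1.mput a b >>= fun a' => k a' c') (l1.mget a) c
  · intro γ k c
    simp only [MLens.comp, bind_assoc]
    have e : ∀ b, (l1.mcreate b >>= fun a' => k a' (l2.mget (l1.mget a'))) =
        (l1.mcreate b >>= fun a' => k a' (l2.mget b)) :=
      fun b => cg1 γ (fun a' b' => k a' (l2.mget b')) b
    simp only [e]
    exact cg2 γ (fun b c' => l1.mcreate b >>= fun a' => k a' c') c
end

section
/- Let l1 be a well-behaved μ-lens from S1 to B and l2 a well-behaved μ-lens from S2 to B over a monad μ satisfying the monad laws. Call a pair (s1,s2) : S1 × S2 consistent if l1.mget s1 = l2.mget s2. Define the left-leg operations of the join on S1 × S2 by: lget (s1,s2) = s1; lput (s1,s2) s1' = l2.mput s2 (l1.mget s1') >>= fun s2' => pure (s1', s2'); lcreate s1 = l2.mcreate (l1.mget s1) >>= fun s2 => pure (s1, s2). Then: (a) for every consistent pair p, lput p p.1 = pure p (the law (MGetPut) at consistent states); (b) for all p, s1', every type γ, and every k : (S1 × S2) → S1 → μ γ, (lput p s1' >>= fun q => k q q.1) = (lput p s1' >>= fun q => k q s1') (the law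 (MPutGet)); (c) for all s1, every k, (lcreate s1 >>= fun q => k q q.1) = (lcreate s1 >>= fun q => k q s1) (the law (MCreateGet)); (d) consistency is preserved: for all p, s1' and all continuations k, k' : S1 × S2 → μ γ such that k q = k' q for every consistent q, we have lput p s1' >>= k = lput p s1' >>= k' and lcreate s1' >>= k = lcreate s1' >>= k'. The symmetric claims hold for the right-leg operations rget (s1,s2) = s2, rput (s1,s2) s2' = l1.mput s1 (l2.mget s2') >>= fun s1' => pure (s1', s2'), rcreate s2 = l1.mcreate (l2.mget s2) >>= fun s1 => pure (s1, s2). -/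
universe u v

section Join

variable {μ : Type u → Type v} [Monad μ] {S1 S2 B : Type u}

/-- A pair of states is consistent if the two lenses' views agree. -/
def Consistent (l1 : MLens μ S1 B) (l2 : MLens μ S2 B) (p : S1 × S2) : Prop :=
  l1.mget p.1 = l2.mget p.2

/-- Left-leg `put` of the join. -/
def joinLPut (l1 : MLens μ S1 B) (l2 : MLens μ S2 B) (p : S1 × S2) (s1' : S1) :
    μ (S1 × S2) :=
  l2.mput p.2 (l1.mget s1') >>= fun s2' => pure (s1', s2')

/-- Left-leg `create` of the join. -/
def joinLCreate (l1 : MLens μ S1 B) (l2 : MLens μ S2 B) (s1 : S1) : μ (S1 × S2) :=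
  l2.mcreate (l1.mget s1) >>= fun s2 => pure (s1, s2)

/-- Right-leg `put` of the join. -/
def joinRPut (l1 : MLens μ S1 B) (l2 : MLens μ S2 B) (p : S1 × S2) (s2' : S2) :
    μ (S1 × S2) :=
  l1.mput p.1 (l2.mget s2') >>= fun s1' => pure (s1', s2')

/-- Right-leg `create` of the join. -/
def joinRCreate (l1 : MLens μ S1 B) (l2 : MLens μ S2 B) (s2 : S2) : μ (S1 × S2) :=
  l1.mcreate (l2.mget s2) >>= fun s1 => pure (s1, s2)

/-- the legs of the join of two well-behaved monadic lenses satisfy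
(MGetPut) at consistent states, (MPutGet), (MCreateGet), and preserve consistency. -/
theorem join_wellBehaved [LawfulMonad μ]
    (l1 : MLens μ S1 B) (l2 : MLens μ S2 B)
    (h1 : l1.WellBehaved) (h2 : l2.WellBehaved) :
    -- (a) left: (MGetPut) at consistent states
    (∀ p : S1 × S2, Consistent l1 l2 p → joinLPut l1 l2 p p.1 = pure p) ∧
    -- (b) left: (MPutGet)
    (∀ (p : S1 × S2) (s1' : S1) (γ : Type u) (k : S1 × S2 → S1 → μ γ),
      (joinLPut l1 l2 p s1' >>= fun q => k q q.1) =
      (joinLPut l1 l2 p s1' >>= fun q => k q s1')) ∧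
    -- (c) left: (MCreateGet)
    (∀ (s1 : S1) (γ : Type u) (k : S1 × S2 → S1 → μ γ),
      (joinLCreate l1 l2 s1 >>= fun q => k q q.1) =
      (joinLCreate l1 l2 s1 >>= fun q => k q s1)) ∧
    -- (d) left: consistency is preserved by put and create
    (∀ (p : S1 × S2) (s1' : S1) (γ : Type u) (k k' : S1 × S2 → μ γ),
      (∀ q, Consistent l1 l2 q → k q = k' q) →
      (joinLPut l1 l2 p s1' >>= k) = (joinLPut l1 l2 p s1' >>= k') ∧
      (joinLCreate l1 l2 s1' >>= k) = (joinLCreate l1 l2 s1' >>= k')) ∧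
    -- (a) right: (MGetPut) at consistent states
    (∀ p : S1 × S2, Consistent l1 l2 p → joinRPut l1 l2 p p.2 = pure p) ∧
    -- (b) right: (MPutGet)
    (∀ (p : S1 × S2) (s2' : S2) (γ : Type u) (k : S1 × S2 → S2 → μ γ),
      (joinRPut l1 l2 p s2' >>= fun q => k q q.2) =
      (joinRPut l1 l2 p s2' >>= fun q => k q s2')) ∧
    -- (c) right: (MCreateGet)
    (∀ (s2 : S2) (γ : Type u) (k : S1 × S2 → S2 → μ γ),
      (joinRCreate l1 l2 s2 >>= fun q => k q q.2) =
      (joinRCreate l1 l2 s2 >>= fun q => k q s2)) ∧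
    -- (d) right: consistency is preserved by put and create
    (∀ (p : S1 × S2) (s2' : S2) (γ : Type u) (k k' : S1 × S2 → μ γ),
      (∀ q, Consistent l1 l2 q → k q = k' q) →
      (joinRPut l1 l2 p s2' >>= k) = (joinRPut l1 l2 p s2' >>= k') ∧
      (joinRCreate l1 l2 s2' >>= k) = (joinRCreate l1 l2 s2' >>= k')) := by
  classical
  -- after a put or create, continuations need only agree on states with the right view
  have key : ∀ {A : Type u} (l : MLens μ A B), l.WellBehaved → ∀ (γ : Type u) (b : B)
      (f g : A → μ γ), (∀ a, b = l.mget a → f a = g a) →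
      (∀ a, (l.mput a b >>= f) = (l.mput a b >>= g)) ∧
      (l.mcreate b >>= f) = (l.mcreate b >>= g) := by
    intro A l h γ b f g hfg
    have e1 : (fun a => if b = l.mget a then f a else g a) = g := by
      funext a
      split_ifs with hb
      · exact hfg a hb
      · rfl
    refine ⟨fun a => ?_, ?_⟩
    · have := h.2.1 γ (fun a c => if b = c then f a else g a) a b
      simp only [e1, if_true] at this
      exact this.symm
    · have := h.2.2 γ (fun a c => if b = c then f a else g a) b
      simp only [e1, if_true] at this
      exact this.symm
  refine ⟨?_, ?_, ?_, ?_, ?_, ?_, ?_, ?_⟩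
  · intro p hp
    unfold Consistent at hp
    simp only [joinLPut, hp, h2.1, pure_bind]
  · intro p s γ k
    simp only [joinLPut, bind_assoc, pure_bind]
  · intro s γ k
    simp only [joinLCreate, bind_assoc, pure_bind]
  · intro p s γ k k' hk
    simp only [joinLPut, joinLCreate, bind_assoc, pure_bind]
    have := key l2 h2 γ (l1.mget s) (fun x => k (s, x)) (fun x => k' (s, x))
      (fun a ha => hk (s, a) ha)
    exact ⟨this.1 _, this.2⟩
  · intro p hp
    unfold Consistent at hp
    simp only [joinRPut, ← hp, h1.1, pure_bind]
  · intro p s γ k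
    simp only [joinRPut, bind_assoc, pure_bind]
  · intro s γ k
    simp only [joinRCreate, bind_assoc, pure_bind]
  · intro p s γ k k' hk
    simp only [joinRPut, joinRCreate, bind_assoc, pure_bind]
    have := key l1 h1 γ (l2.mget s) (fun x => k (x, s)) (fun x => k' (x, s))
      (fun a ha => hk (a, s) ha.symm)
    exact ⟨this.1 _, this.2⟩

end Join
end

section
/- Let (left, right) be a well-behaved span of μ-lenses from A to B with state S, over a monad μ satisfying the monad laws. Define a monadic symmetric lens between A and B with complement Option S by: missing = none; mputR (a, some s) = left.mput s a >>= fun s' => pure (right.mget s', some s'); mputR (a, none) = left.mcreate a >>= fun s' => pure (right.mget s', some s'); mputL (b, some s) = right.mput s b >>= fun s' => pure (left.mget s', some s'); mputL (b, none) = right.mcreate b >>= fun s' => pure (left.mget s', some s'). Then this monadic symmetric lens is well-behaved: it satisfies (PutRLM) and (PutLRM). -/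
universe u v

/-- A span of monadic lenses from `A` to `B` with state `S`. -/
structure Span (μ : Type u → Type v) (S A B : Type u) where
  left : MLens μ S A
  right : MLens μ S B

/-- A span is well-behaved if both its legs are. -/
def Span.WellBehaved {μ : Type u → Type v} [Monad μ] {S A B : Type u}
    (sp : Span μ S A B) : Prop :=
  sp.left.WellBehaved ∧ sp.right.WellBehaved

structure SMLens (μ : Type u → Type v) (A B C : Type u) where
  mputR : A × C → μ (B × C)
  mputL : B × C → μ (A × C)
  missing : C

/-- A monadic symmetric lens is well-behaved if it satisfies (PutRLM) and (PutLRM). -/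
def SMLens.WellBehaved {μ : Type u → Type v} [Monad μ] {A B C : Type u}
    (sl : SMLens μ A B C) : Prop :=
  (∀ (a : A) (c : C),
    (sl.mputR (a, c) >>= fun p => sl.mputL p) =
    (sl.mputR (a, c) >>= fun p => pure (a, p.2))) ∧
  (∀ (b : B) (c : C),
    (sl.mputL (b, c) >>= fun q => sl.mputR q) =
    (sl.mputL (b, c) >>= fun q => pure (b, q.2)))

/-- Converting a span of monadic lenses into a monadic symmetric lens with
complement `Option S`. -/
def span2smlens {μ : Type u → Type v} [Monad μ] {S A B : Type u}
    (sp : Span μ S A B) : SMLens μ A B (Option S) where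
  mputR := fun p =>
    match p.2 with
    | some s => sp.left.mput s p.1 >>= fun s' => pure (sp.right.mget s', some s')
    | none => sp.left.mcreate p.1 >>= fun s' => pure (sp.right.mget s', some s')
  mputL := fun p =>
    match p.2 with
    | some s => sp.right.mput s p.1 >>= fun s' => pure (sp.left.mget s', some s')
    | none => sp.right.mcreate p.1 >>= fun s' => pure (sp.left.mget s', some s')
  missing := none

/-- `span2smlens` maps well-behaved spans to well-behaved monadic
symmetric lenses. -/
theorem span2smlens_wellBehaved {μ : Type u → Type v} [Monad μ] [LawfulMonad μ]
    {S A B : Type u} (sp : Span μ S A B) (h : sp.WellBehaved) :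
    (span2smlens sp).WellBehaved := by
  obtain ⟨⟨hl1, hl2, hl3⟩, ⟨hr1, hr2, hr3⟩⟩ := h
  refine ⟨?_, ?_⟩
  · rintro a (_ | s)
    · simp only [span2smlens, bind_assoc, pure_bind, hr1]
      exact hl3 _ (fun s' a' => pure (a', some s')) a
    · simp only [span2smlens, bind_assoc, pure_bind, hr1]
      exact hl2 _ (fun s' a' => pure (a', some s')) s a
  · rintro b (_ | s)
    · simp only [span2smlens, bind_assoc, pure_bind, hl1]
      exact hr3 _ (fun s' b' => pure (b', some s')) b
    · simp only [span2smlens, bind_assoc, pure_bind, hl1]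
      exact hr2 _ (fun s' b' => pure (b', some s')) s b
end

section
/- Let sl be a well-behaved pure symmetric lens between A and B with complement C, and let S be the set of consistent triples: S = {(a,b,c) : A × B × C | sl.putR (a,c) = (b,c) ∧ sl.putL (b,c) = (a,c)}. Then: (i) for every c : C and a' : A, writing (b',c') = sl.putR (a',c), the triple (a',b',c') is in S; for every c : C and b' : B, writing (a',c') = sl.putL (b',c), the triple (a',b',c') is in S; in particular the triples produced from sl.missing by putR or putL are in S; (ii) the pure lens from S to A with get (a,b,c) = a, put (a,b,c) a' = (a', b', c') where (b',c') = sl.putR (a',c), and create a = (a, b, c) where (b,c) = sl.putR (a, sl.missing), is well-behaved (satisfies (GetPut), (PutGet), (CreateGet)); and symmetrically the pure lens from S to B with get (a,b,c) = b, put (a,b,c) b' = (a', b', c') where (a',c') = sl.putL (b',c), and create b = (a, b, c) where (a,c) = sl.putL (b, sl.missing), is well-behaved. Hence (left, right) is a well-behaved span of pure lenses from A to B with state S. -/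
universe u

structure Lens (A B : Type u) where
  get : A → B
  put : A → B → A
  create : B → A

/-- A pure lens is well-behaved if it satisfies (GetPut), (PutGet) and (CreateGet). -/
def Lens.WellBehaved {A B : Type u} (l : Lens A B) : Prop :=
  (∀ a, l.put a (l.get a) = a) ∧
  (∀ a b, l.get (l.put a b) = b) ∧
  (∀ b, l.get (l.create b) = b)

structure SLens (A B C : Type u) where
  putR : A × C → B × C
  putL : B × C → A × C
  missing : C

/-- A pure symmetric lens is well-behaved if it satisfies (PutRL) and (PutLR). -/
def SLens.WellBehaved {A B C : Type u} (sl : SLens A B C) : Prop :=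
  (∀ (a : A) (c : C), sl.putL (sl.putR (a, c)) = (a, (sl.putR (a, c)).2)) ∧
  (∀ (b : B) (c : C), sl.putR (sl.putL (b, c)) = (b, (sl.putL (b, c)).2))

/-- A triple `(a, b, c)` is consistent for `sl`. -/
def SLens.Consistent {A B C : Type u} (sl : SLens A B C) (t : A × B × C) : Prop :=
  sl.putR (t.1, t.2.2) = (t.2.1, t.2.2) ∧ sl.putL (t.2.1, t.2.2) = (t.1, t.2.2)

/-- from a well-behaved pure symmetric lens one obtains a well-behaved
span of pure lenses over the set of consistent triples. -/
theorem smlens2span_wellBehaved {A B C : Type u} (sl : SLens A B C)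
    (h : sl.WellBehaved) :
    -- (i) putR and putL produce consistent triples
    (∀ (c : C) (a' : A),
      sl.Consistent (a', (sl.putR (a', c)).1, (sl.putR (a', c)).2)) ∧
    (∀ (c : C) (b' : B),
      sl.Consistent ((sl.putL (b', c)).1, b', (sl.putL (b', c)).2)) ∧
    -- (ii) the two legs over the consistent triples are well-behaved lenses
    (∃ (left : Lens {t : A × B × C // sl.Consistent t} A)
       (right : Lens {t : A × B × C // sl.Consistent t} B),
      left.WellBehaved ∧ right.WellBehaved ∧
      (∀ s, left.get s = s.val.1) ∧
      (∀ s a', (left.put s a').val =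
        (a', (sl.putR (a', s.val.2.2)).1, (sl.putR (a', s.val.2.2)).2)) ∧
      (∀ a : A, (left.create a).val =
        (a, (sl.putR (a, sl.missing)).1, (sl.putR (a, sl.missing)).2)) ∧
      (∀ s, right.get s = s.val.2.1) ∧
      (∀ s b', (right.put s b').val =
        ((sl.putL (b', s.val.2.2)).1, b', (sl.putL (b', s.val.2.2)).2)) ∧
      (∀ b : B, (right.create b).val =
        ((sl.putL (b, sl.missing)).1, b, (sl.putL (b, sl.missing)).2))) := by
  obtain ⟨hRL, hLR⟩ := h
  have h1 : ∀ (c : C) (a' : A),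
      sl.Consistent (a', (sl.putR (a', c)).1, (sl.putR (a', c)).2) := by
    intro c a'
    have e := hRL a' c
    have e2 := hLR (sl.putR (a', c)).1 (sl.putR (a', c)).2
    simp only [Prod.mk.eta, e] at e2
    exact ⟨e2, e⟩
  have h2 : ∀ (c : C) (b' : B),
      sl.Consistent ((sl.putL (b', c)).1, b', (sl.putL (b', c)).2) := by
    intro c b'
    have e := hLR b' c
    have e2 := hRL (sl.putL (b', c)).1 (sl.putL (b', c)).2
    simp only [Prod.mk.eta, e] at e2
    exact ⟨e, e2⟩
  refine ⟨h1, h2,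
    ⟨fun s => s.val.1, fun s a' => ⟨_, h1 s.val.2.2 a'⟩, fun a => ⟨_, h1 sl.missing a⟩⟩,
    ⟨fun s => s.val.2.1, fun s b' => ⟨_, h2 s.val.2.2 b'⟩, fun b => ⟨_, h2 sl.missing b⟩⟩,
    ⟨?_, fun _ _ => rfl, fun _ => rfl⟩, ⟨?_, fun _ _ => rfl, fun _ => rfl⟩,
    fun _ => rfl, fun _ _ => rfl, fun _ => rfl, fun _ => rfl, fun _ _ => rfl, fun _ => rfl⟩
  · rintro ⟨⟨a, b, c⟩, hs⟩
    have e : sl.putR (a, c) = (b, c) := hs.1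
    apply Subtype.ext
    simp [e]
  · rintro ⟨⟨a, b, c⟩, hs⟩
    have e : sl.putL (b, c) = (a, c) := hs.2
    apply Subtype.ext
    simp [e]
end

section
/- If sl1 is a well-behaved pure symmetric lens between X and Y with complement C1 and sl2 is a well-behaved pure symmetric lens between Y and Z with complement C2, then their composition sl1 ; sl2 — the pure symmetric lens between X and Z with complement C1 × C2, missing = (sl1.missing, sl2.missing), putR (x,(c1,c2)) = (z,(c1',c2')) where (y,c1') = sl1.putR (x,c1) and (z,c2') = sl2.putR (y,c2), and putL (z,(c1,c2)) = (x,(c1',c2')) where (y,c2') = sl2.putL (z,c2) and (x,c1') = sl1.putL (y,c1) — is well-behaved. -/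
universe u

/-- Composition of pure symmetric lenses. -/
def SLens.comp {X Y Z C1 C2 : Type u} (sl1 : SLens X Y C1) (sl2 : SLens Y Z C2) :
    SLens X Z (C1 × C2) where
  putR := fun p =>
    let q := sl1.putR (p.1, p.2.1)
    let r := sl2.putR (q.1, p.2.2)
    (r.1, (q.2, r.2))
  putL := fun p =>
    let q := sl2.putL (p.1, p.2.2)
    let r := sl1.putL (q.1, p.2.1)
    (r.1, (r.2, q.2))
  missing := (sl1.missing, sl2.missing)

/-- the composition of well-behaved pure symmetric lenses is
well-behaved. -/
theorem slens_comp_wellBehaved {X Y Z C1 C2 : Type u}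
    (sl1 : SLens X Y C1) (sl2 : SLens Y Z C2)
    (h1 : sl1.WellBehaved) (h2 : sl2.WellBehaved) :
    (sl1.comp sl2).WellBehaved := by
  obtain ⟨h1a, h1b⟩ := h1
  obtain ⟨h2a, h2b⟩ := h2
  constructor
  · rintro x ⟨c1, c2⟩
    simp [SLens.comp, h1a, h2a]
  · rintro z ⟨c1, c2⟩
    simp [SLens.comp, h1b, h2b]
end

section
/- Let l1 be a well-behaved pure lens from A to B and l2 a well-behaved pure lens from C to B, and let S = {(a,c) : A × C | l1.get a = l2.get c}. Define pure lenses l from S to A by l.get (a,c) = a, l.put (a,c) a' = (a', l2.put c (l1.get a')), l.create a' = (a', l2.create (l1.get a')) (these values lie in S by (PutGet) and (CreateGet) for l2), and symmetrically r from S to C by r.get (a,c) = c, r.put (a,c) c' = (l1.put a (l2.get c'), c'), r.create c' = (l1.create (l2.get c'), c'). Then l ; l1 = r ; l2 as pure lenses from S to B; explicitly, for all p ∈ S and b : B: l1.get p.1 = l2.get p.2; l.put p (l1.put p.1 b) = r.put p (l2.put p.2 b); and l.create (l1.create b) = r.create (l2.create b). -/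
universe u

/-- Composition of pure lenses. -/
def Lens.comp {A B C : Type u} (l1 : Lens A B) (l2 : Lens B C) : Lens A C where
  get a := l2.get (l1.get a)
  put a c := l1.put a (l2.put (l1.get a) c)
  create c := l1.create (l2.create c)

/-- Left leg of the join of two lenses with a common view type, defined on the set
of consistent state pairs. -/
def joinLeft {A B C : Type u} (l1 : Lens A B) (l2 : Lens C B) (h2 : l2.WellBehaved) :
    Lens {p : A × C // l1.get p.1 = l2.get p.2} A where
  get p := p.val.1
  put p a' := ⟨(a', l2.put p.val.2 (l1.get a')), (h2.2.1 _ _).symm⟩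
  create a' := ⟨(a', l2.create (l1.get a')), (h2.2.2 _).symm⟩

/-- Right leg of the join of two lenses with a common view type. -/
def joinRight {A B C : Type u} (l1 : Lens A B) (l2 : Lens C B) (h1 : l1.WellBehaved) :
    Lens {p : A × C // l1.get p.1 = l2.get p.2} C where
  get p := p.val.2
  put p c' := ⟨(l1.put p.val.1 (l2.get c'), c'), h1.2.1 _ _⟩
  create c' := ⟨(l1.create (l2.get c'), c'), h1.2.2 _⟩

/-- the two legs of the join, composed with the original lenses,
coincide: `l ; l1 = r ; l2`. -/
theorem join_comm {A B C : Type u} (l1 : Lens A B) (l2 : Lens C B)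
    (h1 : l1.WellBehaved) (h2 : l2.WellBehaved) :
    (joinLeft l1 l2 h2).comp l1 = (joinRight l1 l2 h1).comp l2 ∧
    (∀ (p : {p : A × C // l1.get p.1 = l2.get p.2}) (b : B),
      l1.get p.val.1 = l2.get p.val.2 ∧
      (joinLeft l1 l2 h2).put p (l1.put p.val.1 b) =
        (joinRight l1 l2 h1).put p (l2.put p.val.2 b) ∧
      (joinLeft l1 l2 h2).create (l1.create b) =
        (joinRight l1 l2 h1).create (l2.create b)) := by
  have key : ∀ (p : {p : A × C // l1.get p.1 = l2.get p.2}) (b : B),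
      l1.get p.val.1 = l2.get p.val.2 ∧
      (joinLeft l1 l2 h2).put p (l1.put p.val.1 b) =
        (joinRight l1 l2 h1).put p (l2.put p.val.2 b) := by
    intro p b
    refine ⟨p.property, Subtype.ext ?_⟩
    simp only [joinLeft, joinRight, h1.2.1, h2.2.1]
  have keyc : ∀ b : B, (joinLeft l1 l2 h2).create (l1.create b) =
        (joinRight l1 l2 h1).create (l2.create b) := by
    intro b
    refine Subtype.ext ?_
    simp only [joinLeft, joinRight, h1.2.2, h2.2.2]
  refine ⟨?_, fun p b => ⟨(key p b).1, (key p b).2, keyc b⟩⟩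
  unfold Lens.comp
  rw [Lens.mk.injEq]
  exact ⟨funext fun p => p.property, funext fun p => funext fun b => (key p b).2,
    funext keyc⟩
end

section
/- Let sp1 (state S1) and sp2 (state S2) be spans of μ-lenses from A to B over a monad μ satisfying the monad laws. If sp1 ≡s sp2 (span equivalence, the least equivalence relation containing the one-step relation ↷), then there exist a type S and well-behaved pure lenses l from S to S1 and r from S to S2 such that (lift l) ; sp1.left = (lift r) ; sp2.left and (lift l) ; sp1.right = (lift r) ; sp2.right (equalities of μ-lenses, i.e. componentwise equality of mget, mput, and mcreate). -/
universe u v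

/-- Lifting a pure lens to a monadic lens. -/
def Lens.lift {A B : Type u} (μ : Type u → Type v) [Monad μ] (l : Lens A B) :
    MLens μ A B where
  mget := l.get
  mput a b := pure (l.put a b)
  mcreate b := pure (l.create b)

/-- A span of monadic lenses from `A` to `B`, packaged with its state type. -/
structure MSpan (μ : Type u → Type v) (A B : Type u) where
  S : Type u
  left : MLens μ S A
  right : MLens μ S B

/-- The one-step relation `↷` between spans of monadic lenses. -/
def MSpan.Step {μ : Type u → Type v} [Monad μ] {A B : Type u}
    (sp1 sp2 : MSpan μ A B) : Prop :=
  ∃ h : Lens sp1.S sp2.S, h.WellBehaved ∧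
    (h.lift μ).comp sp2.left = sp1.left ∧
    (h.lift μ).comp sp2.right = sp1.right

/-- Span equivalence: the least equivalence relation containing `↷`. -/
def MSpan.SpanEquiv {μ : Type u → Type v} [Monad μ] {A B : Type u} :
    MSpan μ A B → MSpan μ A B → Prop :=
  Relation.EqvGen MSpan.Step

def Lens.cmp {A B C : Type u} (l1 : Lens A B) (l2 : Lens B C) : Lens A C where
  get a := l2.get (l1.get a)
  put a c := l1.put a (l2.put (l1.get a) c)
  create c := l1.create (l2.create c)

theorem Lens.cmp_wb {A B C : Type u} {l1 : Lens A B} {l2 : Lens B C}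
    (h1 : l1.WellBehaved) (h2 : l2.WellBehaved) : (l1.cmp l2).WellBehaved := by
  obtain ⟨a1, b1, c1⟩ := h1
  obtain ⟨a2, b2, c2⟩ := h2
  refine ⟨?_, ?_, ?_⟩ <;> intros <;> simp [Lens.cmp, *]

theorem Lens.lift_cmp {μ : Type u → Type v} [Monad μ] [LawfulMonad μ] {A B C D : Type u}
    (l1 : Lens A B) (l2 : Lens B C) (m : MLens μ C D) :
    ((l1.cmp l2).lift μ).comp m = (l1.lift μ).comp ((l2.lift μ).comp m) := by
  simp [Lens.lift, MLens.comp, Lens.cmp]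

def Lens.idl (A : Type u) : Lens A A where
  get a := a
  put _ b := b
  create b := b

theorem Lens.idl_wb (A : Type u) : (Lens.idl A).WellBehaved :=
  ⟨fun _ => rfl, fun _ _ => rfl, fun _ => rfl⟩

theorem Lens.lift_idl {μ : Type u → Type v} [Monad μ] [LawfulMonad μ] {A B : Type u}
    (m : MLens μ A B) : ((Lens.idl A).lift μ).comp m = m := by
  simp [Lens.lift, MLens.comp, Lens.idl]

/-- Cospans of well-behaved lenses complete to commuting squares. -/
theorem Lens.pullback {S T X : Type u} (f : Lens S X) (g : Lens T X)
    (hf : f.WellBehaved) (hg : g.WellBehaved) :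
    ∃ (P : Type u) (p : Lens P S) (q : Lens P T), p.WellBehaved ∧ q.WellBehaved ∧
      p.cmp f = q.cmp g := by
  obtain ⟨f1, f2, f3⟩ := hf
  obtain ⟨g1, g2, g3⟩ := hg
  refine ⟨{x : S × T // f.get x.1 = g.get x.2},
    ⟨fun x => x.1.1, fun x s => ⟨(s, g.put x.1.2 (f.get s)), by simp [g2]⟩,
      fun s => ⟨(s, g.create (f.get s)), by simp [g3]⟩⟩,
    ⟨fun x => x.1.2, fun x t => ⟨(f.put x.1.1 (g.get t), t), by simp [f2]⟩,
      fun t => ⟨(f.create (g.get t), t), by simp [f3]⟩⟩,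
    ⟨?_, fun _ _ => rfl, fun _ => rfl⟩, ⟨?_, fun _ _ => rfl, fun _ => rfl⟩, ?_⟩
  · rintro ⟨⟨s, t⟩, h⟩
    simp only at h
    simp [h, g1]
  · rintro ⟨⟨s, t⟩, h⟩
    simp only at h
    simp [← h, f1]
  · simp only [Lens.cmp, Lens.mk.injEq]
    refine ⟨?_, ?_, ?_⟩
    · funext x
      exact x.2
    · funext x c
      simp [f2, g2]
    · funext c
      simp [f3, g3]

/-- span-equivalent spans are connected by a single span of
well-behaved pure lenses. -/
theorem spanEquiv_connected {μ : Type u → Type v} [Monad μ] [LawfulMonad μ]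
    {A B : Type u} (sp1 sp2 : MSpan μ A B) (h : sp1.SpanEquiv sp2) :
    ∃ (S : Type u) (l : Lens S sp1.S) (r : Lens S sp2.S),
      l.WellBehaved ∧ r.WellBehaved ∧
      (l.lift μ).comp sp1.left = (r.lift μ).comp sp2.left ∧
      (l.lift μ).comp sp1.right = (r.lift μ).comp sp2.right := by
  induction h with
  | rel x y h =>
    obtain ⟨h, hw, h1, h2⟩ := h
    exact ⟨x.S, Lens.idl _, h, Lens.idl_wb _, hw, by rw [Lens.lift_idl, h1],
      by rw [Lens.lift_idl, h2]⟩
  | refl x => exact ⟨x.S, Lens.idl _, Lens.idl _, Lens.idl_wb _, Lens.idl_wb _, rfl, rfl⟩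
  | symm x y _ ih =>
    obtain ⟨S, l, r, hl, hr, h1, h2⟩ := ih
    exact ⟨S, r, l, hr, hl, h1.symm, h2.symm⟩
  | trans x y z _ _ ih1 ih2 =>
    obtain ⟨S, l, r, hl, hr, h1, h2⟩ := ih1
    obtain ⟨T, l', r', hl', hr', h1', h2'⟩ := ih2
    obtain ⟨P, p, q, hp, hq, hpq⟩ := Lens.pullback r l' hr hl'
    refine ⟨P, p.cmp l, q.cmp r', Lens.cmp_wb hp hl, Lens.cmp_wb hq hr', ?_, ?_⟩
    · rw [Lens.lift_cmp, h1, ← Lens.lift_cmp, hpq, Lens.lift_cmp, h1', ← Lens.lift_cmp]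
    · rw [Lens.lift_cmp, h2, ← Lens.lift_cmp, hpq, Lens.lift_cmp, h2', ← Lens.lift_cmp]
end

section
/- Let sp1 (state S1) and sp2 (state S2) be spans of μ-lenses from A to B over a monad μ satisfying the monad laws. If sp1 ≡s sp2 (span equivalence) then sp1 ≡b sp2 (bisimulation equivalence): there exist a set R ⊆ S1 × S2 and a span of μ-lenses from A to B with state the subtype {p : S1 × S2 // p ∈ R} such that the first projection is a base map from its legs to the corresponding legs of sp1, and the second projection is a base map from its legs to the corresponding legs of sp2. -/
universe u v

/-- `f` is a base map from `l1` to `l2`. -/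
def IsBaseMap {μ : Type u → Type v} [Monad μ] {T1 T2 V : Type u}
    (l1 : MLens μ T1 V) (l2 : MLens μ T2 V) (f : T1 → T2) : Prop :=
  (∀ t, l1.mget t = l2.mget (f t)) ∧
  (∀ t v, (l1.mput t v >>= fun t' => pure (f t')) = l2.mput (f t) v) ∧
  (∀ v, (l1.mcreate v >>= fun t => pure (f t)) = l2.mcreate v)

/-- Bisimulation equivalence of spans of monadic lenses. -/
def MSpan.BisimEquiv {μ : Type u → Type v} [Monad μ] {A B : Type u}
    (sp1 sp2 : MSpan μ A B) : Prop :=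
  ∃ (R : Set (sp1.S × sp2.S))
    (lft : MLens μ {p : sp1.S × sp2.S // p ∈ R} A)
    (rgt : MLens μ {p : sp1.S × sp2.S // p ∈ R} B),
    IsBaseMap lft sp1.left (fun p => p.val.1) ∧
    IsBaseMap rgt sp1.right (fun p => p.val.1) ∧
    IsBaseMap lft sp2.left (fun p => p.val.2) ∧
    IsBaseMap rgt sp2.right (fun p => p.val.2)

theorem step_baseMap {μ : Type u → Type v} [Monad μ] [LawfulMonad μ] {S T V : Type u}
    (h : Lens S T) (hw : h.WellBehaved) (l1 : MLens μ S V) (l2 : MLens μ T V)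
    (e : (h.lift μ).comp l2 = l1) : IsBaseMap l1 l2 h.get := by
  obtain ⟨h1, h2, h3⟩ := hw
  subst e
  refine ⟨fun t => rfl, fun t v => ?_, fun v => ?_⟩
  · simp only [MLens.comp, Lens.lift, bind_assoc, pure_bind, h2, bind_pure]
  · simp only [MLens.comp, Lens.lift, bind_assoc, pure_bind, h3, bind_pure]

def lensComp {A B C : Type u} (h : Lens A B) (k : Lens B C) : Lens A C where
  get a := k.get (h.get a)
  put a c := h.put a (k.put (h.get a) c)
  create c := h.create (k.create c)

theorem lensComp_wb {A B C : Type u} (h : Lens A B) (k : Lens B C)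
    (hh : h.WellBehaved) (hk : k.WellBehaved) : (lensComp h k).WellBehaved := by
  obtain ⟨h1, h2, h3⟩ := hh
  obtain ⟨k1, k2, k3⟩ := hk
  refine ⟨fun a => ?_, fun a b => ?_, fun b => ?_⟩ <;> simp [lensComp, *]

theorem lensComp_lift {μ : Type u → Type v} [Monad μ] [LawfulMonad μ] {A B C V : Type u}
    (h : Lens A B) (k : Lens B C) (l : MLens μ C V) :
    ((lensComp h k).lift μ).comp l = (h.lift μ).comp ((k.lift μ).comp l) := by
  simp only [MLens.comp, Lens.lift, lensComp, bind_assoc, pure_bind]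

theorem step_trans {μ : Type u → Type v} [Monad μ] [LawfulMonad μ] {A B : Type u}
    {sp1 sp2 sp3 : MSpan μ A B} (h12 : sp1.Step sp2) (h23 : sp2.Step sp3) : sp1.Step sp3 := by
  obtain ⟨h, hw, hl, hr⟩ := h12
  obtain ⟨k, kw, kl, kr⟩ := h23
  exact ⟨lensComp h k, lensComp_wb h k hw kw, by rw [lensComp_lift, kl, hl],
    by rw [lensComp_lift, kr, hr]⟩

theorem step_refl {μ : Type u → Type v} [Monad μ] [LawfulMonad μ] {A B : Type u}
    (sp : MSpan μ A B) : sp.Step sp := by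
  refine ⟨⟨id, fun _ b => b, id⟩, ⟨fun _ => rfl, fun _ _ => rfl, fun _ => rfl⟩, ?_, ?_⟩ <;>
    simp [MLens.comp, Lens.lift]

def pbFst {S T U : Type u} (h : Lens S U) (k : Lens T U) (hk : k.WellBehaved) :
    Lens {p : S × T // h.get p.1 = k.get p.2} S where
  get p := p.1.1
  put p s := ⟨(s, k.put p.1.2 (h.get s)), (hk.2.1 _ _).symm⟩
  create s := ⟨(s, k.create (h.get s)), (hk.2.2 _).symm⟩

def pbSnd {S T U : Type u} (h : Lens S U) (k : Lens T U) (hh : h.WellBehaved) :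
    Lens {p : S × T // h.get p.1 = k.get p.2} T where
  get p := p.1.2
  put p t := ⟨(h.put p.1.1 (k.get t), t), hh.2.1 _ _⟩
  create t := ⟨(h.create (k.get t), t), hh.2.2 _⟩

theorem pb_comm {μ : Type u → Type v} [Monad μ] [LawfulMonad μ] {S T U V : Type u}
    (h : Lens S U) (k : Lens T U) (hh : h.WellBehaved) (hk : k.WellBehaved) (l : MLens μ U V) :
    ((pbSnd h k hh).lift μ).comp ((k.lift μ).comp l) =
      ((pbFst h k hk).lift μ).comp ((h.lift μ).comp l) := by
  obtain ⟨h1, h2, h3⟩ := id hh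
  obtain ⟨k1, k2, k3⟩ := id hk
  simp only [MLens.comp, Lens.lift, pbFst, pbSnd, bind_assoc, pure_bind, MLens.mk.injEq]
  refine ⟨?_, ?_, ?_⟩
  · funext p; rw [p.2]
  · funext p c; simp only [p.2, h2, k2]
  · funext c; simp only [h3, k3]

theorem step_pb {μ : Type u → Type v} [Monad μ] [LawfulMonad μ] {A B : Type u}
    {sp1 sp2 sp3 : MSpan μ A B} (h12 : sp1.Step sp2) (h32 : sp3.Step sp2) :
    ∃ sp : MSpan μ A B, sp.Step sp1 ∧ sp.Step sp3 := by
  obtain ⟨h, hw, hl, hr⟩ := h12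
  obtain ⟨k, kw, kl, kr⟩ := h32
  refine ⟨⟨_, ((pbFst h k kw).lift μ).comp sp1.left, ((pbFst h k kw).lift μ).comp sp1.right⟩,
    ⟨pbFst h k kw, ?_, rfl, rfl⟩, ⟨pbSnd h k hw, ?_, ?_, ?_⟩⟩
  · refine ⟨fun p => Subtype.ext (Prod.ext rfl ?_), fun _ _ => rfl, fun _ => rfl⟩
    simp only [pbFst]
    rw [p.2, kw.1]
  · refine ⟨fun p => Subtype.ext (Prod.ext ?_ rfl), fun _ _ => rfl, fun _ => rfl⟩
    simp only [pbSnd]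
    rw [← p.2, hw.1]
  · rw [← hl, ← kl]; exact pb_comm ..
  · rw [← hr, ← kr]; exact pb_comm ..

theorem apex_of_spanEquiv {μ : Type u → Type v} [Monad μ] [LawfulMonad μ] {A B : Type u}
    {sp1 sp2 : MSpan μ A B} (h : sp1.SpanEquiv sp2) :
    ∃ sp : MSpan μ A B, sp.Step sp1 ∧ sp.Step sp2 := by
  induction h with
  | rel x y h => exact ⟨x, step_refl x, h⟩
  | refl x => exact ⟨x, step_refl x, step_refl x⟩
  | symm x y _ ih => obtain ⟨s, a, b⟩ := ih; exact ⟨s, b, a⟩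
  | trans x y z _ _ ih1 ih2 =>
    obtain ⟨s, a, b⟩ := ih1
    obtain ⟨t, c, d⟩ := ih2
    obtain ⟨w, e, f⟩ := step_pb b c
    exact ⟨w, step_trans e a, step_trans f d⟩

/-- Push a lens forward along `f`, using a section `g`. -/
def pushLens {μ : Type u → Type v} [Monad μ] {S T V : Type u} (f : S → T) (g : T → S)
    (l : MLens μ S V) : MLens μ T V where
  mget t := l.mget (g t)
  mput t v := l.mput (g t) v >>= fun s => pure (f s)
  mcreate v := l.mcreate v >>= fun s => pure (f s)

theorem pushLens_baseMap {μ : Type u → Type v} [Monad μ] [LawfulMonad μ] {S T U V : Type u}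
    (f : S → T) (g : T → S) (hg : ∀ t, f (g t) = t) (l : MLens μ S V) (l' : MLens μ U V)
    (q : T → U) (hq : IsBaseMap l l' (fun s => q (f s))) : IsBaseMap (pushLens f g l) l' q := by
  obtain ⟨h1, h2, h3⟩ := hq
  refine ⟨fun t => ?_, fun t v => ?_, fun v => ?_⟩
  · simp only [pushLens, h1, hg]
  · simp only [pushLens, bind_assoc, pure_bind, h2, hg]
  · simp only [pushLens, bind_assoc, pure_bind, h3]

/-- span equivalence implies bisimulation equivalence. -/
theorem spanEquiv_implies_bisimEquiv {μ : Type u → Type v} [Monad μ] [LawfulMonad μ]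
    {A B : Type u} (sp1 sp2 : MSpan μ A B) (h : sp1.SpanEquiv sp2) :
    sp1.BisimEquiv sp2 := by
  obtain ⟨sp, ⟨h, hw, hl, hr⟩, ⟨k, kw, kl, kr⟩⟩ := apex_of_spanEquiv h
  let R : Set (sp1.S × sp2.S) := Set.range fun s => (h.get s, k.get s)
  let f : sp.S → {p : sp1.S × sp2.S // p ∈ R} := fun s => ⟨(h.get s, k.get s), s, rfl⟩
  let g : {p : sp1.S × sp2.S // p ∈ R} → sp.S := fun p => p.2.choose
  have hg : ∀ t, f (g t) = t := fun t => Subtype.ext t.2.choose_spec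
  exact ⟨R, pushLens f g sp.left, pushLens f g sp.right,
    pushLens_baseMap f g hg _ _ _ (step_baseMap h hw _ _ hl),
    pushLens_baseMap f g hg _ _ _ (step_baseMap h hw _ _ hr),
    pushLens_baseMap f g hg _ _ _ (step_baseMap k kw _ _ kl),
    pushLens_baseMap f g hg _ _ _ (step_baseMap k kw _ _ kr)⟩
end
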